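/- Let ψ : ℝ² → ℂ be infinitely smooth on the closed half-plane {(x,t) : x ≥ 0}, satisfy the Dirichlet boundary condition ψ(0,t) = 0 for all t, and satisfy the decay condition: for all nonnegative integers α, β, γ and all reals A₁ < A₂, sup_{A₁ ≤ t ≤ A₂} |x^α ∂_t^β ∂_x^γ ψ(x,t)| → 0 as x → +∞. Let Lψ = i ∂ψ/∂t + (1/2) ∂²ψ/∂x² + x t ψ (which need not vanish). Then for all t₁ ≤ t₂, | ‖ψ(·,t₂)‖_{L²(0,+∞)} − ‖ψ(·,t₁)‖_{L²(0,+∞)} | ≤ ∫_{t₁}^{t₂} ‖(Lψ)(·,t′)‖_{L²(0,+∞)} dt′. -/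

import Mathlib

open MeasureTheory Filter Set Function

noncomputable section

/-- Partial derivative in the first variable. -/
def pdX (f : ℝ → ℝ → ℂ) : ℝ → ℝ → ℂ := fun x t => deriv (fun y => f y t) x

/-- Partial derivative in the second variable. -/
def pdT (f : ℝ → ℝ → ℂ) : ℝ → ℝ → ℂ := fun x t => deriv (fun s => f x s) t

/-- L² norm over the half-line (0,∞). -/
def L2h (f : ℝ → ℂ) : ℝ := Real.sqrt (∫ x in Set.Ioi (0:ℝ), ‖f x‖^2)

/-- L² norm over ℝ. -/
def L2R (f : ℝ → ℂ) : ℝ := Real.sqrt (∫ x : ℝ, ‖f x‖^2)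

/-- The Schrödinger-type operator L ψ = i ψ_t + (1/2) ψ_xx + x t ψ. -/
def Lop (f : ℝ → ℝ → ℂ) : ℝ → ℝ → ℂ :=
  fun x t => Complex.I * pdT f x t + (1/2) * pdX (pdX f) x t + (x:ℂ) * (t:ℂ) * f x t

open scoped ContDiff Topology

/-- The closed right half-plane. -/
def rightHalf : Set (ℝ × ℝ) := {p | 0 ≤ p.1}

/-- Continuity on the closed half-plane and super-algebraic decay in the first variable,
locally uniformly in the second. -/
def RapidDecay (g : ℝ × ℝ → ℂ) : Prop :=
  ContinuousOn g rightHalf ∧ ∀ (α : ℕ) (A B : ℝ), ∃ C : ℝ, ∀ x > 0, ∀ t ∈ Icc A B,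
    x ^ α * ‖g (x, t)‖ ≤ C

theorem uniqueDiffOn_rightHalf : UniqueDiffOn ℝ rightHalf := by
  have : rightHalf = Ici (0 : ℝ) ×ˢ (univ : Set ℝ) := by
    ext p; simp [rightHalf]
  rw [this]
  exact (uniqueDiffOn_Ici 0).prod uniqueDiffOn_univ

theorem rightHalf_mem_nhds {p : ℝ × ℝ} (hp : 0 < p.1) : rightHalf ∈ 𝓝 p := by
  filter_upwards [(isOpen_lt continuous_const continuous_fst).mem_nhds hp] with q hq
  exact le_of_lt hq

theorem exists_directional_derivative {f : ℝ × ℝ → ℂ} (hf : ContDiffOn ℝ ∞ f rightHalf)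
    (v : ℝ × ℝ) : ∃ g : ℝ × ℝ → ℂ, ContDiffOn ℝ ∞ g rightHalf ∧
      ∀ p : ℝ × ℝ, 0 < p.1 → ∃ f' : ℝ × ℝ →L[ℝ] ℂ, HasFDerivAt f f' p ∧ f' v = g p := by
  refine ⟨fun p => fderivWithin ℝ f rightHalf p v, ?_, fun p hp => ?_⟩
  · exact (hf.fderivWithin uniqueDiffOn_rightHalf (by simp)).clm_apply contDiffOn_const
  · refine ⟨fderivWithin ℝ f rightHalf p, ?_, rfl⟩
    exact ((hf.differentiableOn (by simp) p hp.le).hasFDerivWithinAt).hasFDerivAt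
      (rightHalf_mem_nhds hp)

theorem exists_partial_fst {f : ℝ × ℝ → ℂ} (hf : ContDiffOn ℝ ∞ f rightHalf) :
    ∃ g : ℝ × ℝ → ℂ, ContDiffOn ℝ ∞ g rightHalf ∧
      ∀ x > 0, ∀ t, HasDerivAt (fun y => f (y, t)) (g (x, t)) x := by
  obtain ⟨g, hg, h⟩ := exists_directional_derivative hf (1, 0)
  refine ⟨g, hg, fun x hx t => ?_⟩
  obtain ⟨f', hf', he⟩ := h (x, t) hx
  rw [← he]
  exact hf'.comp_hasDerivAt x ((hasDerivAt_id x).prodMk (hasDerivAt_const x t))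

theorem exists_partial_snd {f : ℝ × ℝ → ℂ} (hf : ContDiffOn ℝ ∞ f rightHalf) :
    ∃ g : ℝ × ℝ → ℂ, ContDiffOn ℝ ∞ g rightHalf ∧
      ∀ x > 0, ∀ t, HasDerivAt (fun s => f (x, s)) (g (x, t)) t := by
  obtain ⟨g, hg, h⟩ := exists_directional_derivative hf (0, 1)
  refine ⟨g, hg, fun x hx t => ?_⟩
  obtain ⟨f', hf', he⟩ := h (x, t) hx
  rw [← he]
  exact hf'.comp_hasDerivAt t ((hasDerivAt_const t x).prodMk (hasDerivAt_id t))

namespace RapidDecay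

theorem of_eventually {g : ℝ × ℝ → ℂ} (hg : ContinuousOn g rightHalf)
    (hd : ∀ (α : ℕ) (A B : ℝ), A < B → ∃ X : ℝ, ∀ x ≥ X, 0 < x → ∀ t ∈ Icc A B,
      x ^ α * ‖g (x, t)‖ < 1) : RapidDecay g := by
  refine ⟨hg, fun α A B => ?_⟩
  obtain ⟨X, hX⟩ := hd α A (max B (A + 1)) (by simp)
  have hK : IsCompact (Icc (0 : ℝ) X ×ˢ Icc A B) := isCompact_Icc.prod isCompact_Icc
  have hc : ContinuousOn (fun p : ℝ × ℝ => p.1 ^ α * ‖g p‖) (Icc (0 : ℝ) X ×ˢ Icc A B) :=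
    (by fun_prop : ContinuousOn (fun p : ℝ × ℝ => p.1 ^ α) _).mul
      (hg.mono fun p hp => hp.1.1).norm
  obtain ⟨C, hC⟩ := hK.exists_bound_of_continuousOn hc
  refine ⟨max C 1, fun x hx t ht => ?_⟩
  rcases le_total x X with h | h
  · exact (le_abs_self _).trans ((hC (x, t) ⟨⟨hx.le, h⟩, ht⟩).trans (le_max_left _ _))
  · exact (hX x h hx t ⟨ht.1, ht.2.trans (le_max_left _ _)⟩).le.trans (le_max_right _ _)

theorem add {f g : ℝ × ℝ → ℂ} (hf : RapidDecay f) (hg : RapidDecay g) :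
    RapidDecay (fun p => f p + g p) := by
  refine ⟨hf.1.add hg.1, fun α A B => ?_⟩
  obtain ⟨C, hC⟩ := hf.2 α A B
  obtain ⟨D, hD⟩ := hg.2 α A B
  refine ⟨C + D, fun x hx t ht => ?_⟩
  have h1 := hC x hx t ht
  have h2 := hD x hx t ht
  have h3 : x ^ α * ‖f (x, t) + g (x, t)‖ ≤ x ^ α * (‖f (x, t)‖ + ‖g (x, t)‖) := by
    gcongr
    exact norm_add_le _ _
  linarith

theorem const_mul {f : ℝ × ℝ → ℂ} (hf : RapidDecay f) (c : ℂ) :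
    RapidDecay (fun p => c * f p) := by
  refine ⟨continuousOn_const.mul hf.1, fun α A B => ?_⟩
  obtain ⟨C, hC⟩ := hf.2 α A B
  refine ⟨‖c‖ * C, fun x hx t ht => ?_⟩
  have := mul_le_mul_of_nonneg_left (hC x hx t ht) (norm_nonneg c)
  rw [norm_mul]
  linarith

theorem coord_mul {f : ℝ × ℝ → ℂ} (hf : RapidDecay f) :
    RapidDecay (fun p => (p.1 : ℂ) * (p.2 : ℂ) * f p) := by
  refine ⟨ContinuousOn.mul (by fun_prop) hf.1, fun α A B => ?_⟩
  obtain ⟨C, hC⟩ := hf.2 (α + 1) A B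
  refine ⟨max |A| |B| * C, fun x hx t ht => ?_⟩
  have h1 := hC x hx t ht
  have h2 : |t| ≤ max |A| |B| := abs_le_max_abs_abs ht.1 ht.2
  have h3 : 0 ≤ x ^ (α + 1) * ‖f (x, t)‖ := by positivity
  calc x ^ α * ‖(x : ℂ) * (t : ℂ) * f (x, t)‖ = |t| * (x ^ (α + 1) * ‖f (x, t)‖) := by
        simp only [norm_mul, Complex.norm_real, Real.norm_eq_abs, abs_of_pos hx]
        ring
    _ ≤ max |A| |B| * C := by gcongr

theorem norm_le {f : ℝ × ℝ → ℂ} (hf : RapidDecay f) (A B : ℝ) :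
    ∃ C ≥ 0, ∀ x > 0, ∀ t ∈ Icc A B, ‖f (x, t)‖ ≤ C * (1 + x ^ 2)⁻¹ ∧ ‖f (x, t)‖ ≤ C := by
  obtain ⟨C, hC⟩ := hf.2 0 A B
  obtain ⟨D, hD⟩ := hf.2 2 A B
  refine ⟨|C| + |D|, by positivity, fun x hx t ht => ?_⟩
  have h1 := hC x hx t ht
  have h2 := hD x hx t ht
  have h3 := le_abs_self C
  have h4 := le_abs_self D
  have h5 := abs_nonneg D
  rw [pow_zero, one_mul] at h1
  refine ⟨?_, by linarith⟩
  rw [← div_eq_mul_inv, le_div_iff₀ (by positivity)]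
  linarith

theorem norm_mul_le {f g : ℝ × ℝ → ℂ} (hf : RapidDecay f) (hg : RapidDecay g) (A B : ℝ) :
    ∃ C, ∀ x > 0, ∀ t ∈ Icc A B, ‖f (x, t)‖ * ‖g (x, t)‖ ≤ C * (1 + x ^ 2)⁻¹ := by
  obtain ⟨C, hC0, hC⟩ := hf.norm_le A B
  obtain ⟨D, hD0, hD⟩ := hg.norm_le A B
  refine ⟨C * D, fun x hx t ht => ?_⟩
  calc ‖f (x, t)‖ * ‖g (x, t)‖ ≤ (C * (1 + x ^ 2)⁻¹) * D := by
        gcongr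
        · exact (hC x hx t ht).1
        · exact (hD x hx t ht).2
    _ = C * D * (1 + x ^ 2)⁻¹ := by ring

theorem aestronglyMeasurable {f : ℝ × ℝ → ℂ} (hf : RapidDecay f) (t : ℝ) :
    AEStronglyMeasurable (fun x => f (x, t)) (volume.restrict (Ioi 0)) := by
  refine ContinuousOn.aestronglyMeasurable ?_ measurableSet_Ioi
  exact hf.1.comp (by fun_prop) fun x (hx : 0 < x) => hx.le

theorem integrable_mul_norm {f g : ℝ × ℝ → ℂ} (hf : RapidDecay f) (hg : RapidDecay g) (t : ℝ) :
    Integrable (fun x => ‖f (x, t)‖ * ‖g (x, t)‖) (volume.restrict (Ioi 0)) := by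
  obtain ⟨C, hC⟩ := hf.norm_mul_le hg t t
  refine (integrable_inv_one_add_sq.restrict.const_mul C).mono'
    ((hf.aestronglyMeasurable t).norm.mul (hg.aestronglyMeasurable t).norm) ?_
  filter_upwards [ae_restrict_mem measurableSet_Ioi] with x hx
  rw [Real.norm_of_nonneg (by positivity)]
  exact hC x hx t (by simp)

theorem integrable_inner {f g : ℝ × ℝ → ℂ} (hf : RapidDecay f) (hg : RapidDecay g) (t : ℝ) :
    Integrable (fun x => inner ℝ (f (x, t)) (g (x, t))) (volume.restrict (Ioi 0)) := by
  refine (hf.integrable_mul_norm hg t).mono'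
    ((hf.aestronglyMeasurable t).inner (hg.aestronglyMeasurable t)) ?_
  exact ae_of_all _ fun x => norm_inner_le_norm _ _

theorem integrable_norm_sq {f : ℝ × ℝ → ℂ} (hf : RapidDecay f) (t : ℝ) :
    Integrable (fun x => ‖f (x, t)‖ ^ 2) (volume.restrict (Ioi 0)) := by
  simpa only [sq] using hf.integrable_mul_norm hf t

theorem continuous_integral_norm_sq {f : ℝ × ℝ → ℂ} (hf : RapidDecay f) :
    Continuous fun t => ∫ x in Ioi (0 : ℝ), ‖f (x, t)‖ ^ 2 := by
  rw [continuous_iff_continuousAt]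
  intro t
  obtain ⟨C, hC⟩ := hf.norm_mul_le hf (t - 1) (t + 1)
  refine continuousAt_of_dominated
    (.of_forall fun s => (hf.integrable_norm_sq s).aestronglyMeasurable)
    (bound := fun x => C * (1 + x ^ 2)⁻¹) ?_ (integrable_inv_one_add_sq.restrict.const_mul C) ?_
  · filter_upwards [Icc_mem_nhds (by linarith : t - 1 < t) (by linarith : t < t + 1)] with s hs
    filter_upwards [ae_restrict_mem measurableSet_Ioi] with x hx
    rw [Real.norm_of_nonneg (by positivity), sq]
    exact hC x hx s hs
  · filter_upwards [ae_restrict_mem measurableSet_Ioi] with x hx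
    have h1 : ContinuousAt f (x, t) := hf.1.continuousAt (rightHalf_mem_nhds hx)
    have h2 : ContinuousAt (fun s => f (x, s)) t :=
      ContinuousAt.comp (f := fun s : ℝ => (x, s)) h1 (by fun_prop)
    exact h2.norm.pow 2

theorem integral_norm_mul_norm_le {f g : ℝ × ℝ → ℂ} (hf : RapidDecay f) (hg : RapidDecay g)
    (t : ℝ) : ∫ x in Ioi (0 : ℝ), ‖f (x, t)‖ * ‖g (x, t)‖ ≤
      L2h (fun x => f (x, t)) * L2h (fun x => g (x, t)) := by
  have h (f : ℝ × ℝ → ℂ) (hf : RapidDecay f) : MemLp (fun x => ‖f (x, t)‖) (ENNReal.ofReal 2)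
      (volume.restrict (Ioi 0)) := by
    rw [ENNReal.ofReal_ofNat, memLp_two_iff_integrable_sq (hf.aestronglyMeasurable t).norm]
    exact hf.integrable_norm_sq t
  have := integral_mul_le_Lp_mul_Lq_of_nonneg (μ := volume.restrict (Ioi (0 : ℝ)))
    Real.HolderConjugate.two_two (f := fun x => ‖f (x, t)‖) (g := fun x => ‖g (x, t)‖)
    (ae_of_all _ fun x => norm_nonneg _) (ae_of_all _ fun x => norm_nonneg _) (h f hf) (h g hg)
  simpa [L2h, Real.sqrt_eq_rpow] using this

theorem hasDerivAt_integral_norm_sq {u ut : ℝ × ℝ → ℂ} (hu : RapidDecay u) (hut : RapidDecay ut)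
    (hd : ∀ x > 0, ∀ t, HasDerivAt (fun s => u (x, s)) (ut (x, t)) t) (t : ℝ) :
    HasDerivAt (fun s => ∫ x in Ioi (0 : ℝ), ‖u (x, s)‖ ^ 2)
      (∫ x in Ioi (0 : ℝ), 2 * inner ℝ (u (x, t)) (ut (x, t))) t := by
  obtain ⟨C, hC⟩ := hu.norm_mul_le hut (t - 1) (t + 1)
  refine (hasDerivAt_integral_of_dominated_loc_of_deriv_le
    (bound := fun x => 2 * (C * (1 + x ^ 2)⁻¹))
    (F' := fun s x => 2 * inner ℝ (u (x, s)) (ut (x, s)))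
    (Icc_mem_nhds (by linarith : t - 1 < t) (by linarith : t < t + 1))
    (.of_forall fun s => (hu.integrable_norm_sq s).aestronglyMeasurable)
    (hu.integrable_norm_sq t)
    ((hu.integrable_inner hut t).const_mul 2).aestronglyMeasurable ?_
    ((integrable_inv_one_add_sq.restrict.const_mul C).const_mul 2) ?_).2
  · filter_upwards [ae_restrict_mem measurableSet_Ioi] with x hx s hs
    rw [norm_mul, Real.norm_of_nonneg zero_le_two]
    gcongr
    exact (norm_inner_le_norm _ _).trans (hC x hx s hs)
  · filter_upwards [ae_restrict_mem measurableSet_Ioi] with x hx s hs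
    exact (hd x hx s).norm_sq

theorem integral_inner_I_mul_eq_zero {u ux uxx : ℝ × ℝ → ℂ} (hu : RapidDecay u)
    (hux : RapidDecay ux) (huxx : RapidDecay uxx) (hbc : ∀ t, u (0, t) = 0)
    (hd : ∀ x > 0, ∀ t, HasDerivAt (fun y => u (y, t)) (ux (x, t)) x)
    (hdd : ∀ x > 0, ∀ t, HasDerivAt (fun y => ux (y, t)) (uxx (x, t)) x) (t : ℝ) :
    ∫ x in Ioi (0 : ℝ), inner ℝ (u (x, t)) (Complex.I * uxx (x, t)) = 0 := by
  have hcont (f : ℝ × ℝ → ℂ) (hf : RapidDecay f) :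
      ContinuousWithinAt (fun x => f (x, t)) (Ici 0) 0 :=
    (hf.1 (0, t) (by simp [rightHalf])).comp (f := fun x : ℝ => (x, t)) (by fun_prop)
      fun x hx => hx
  obtain ⟨C, hC⟩ := hu.norm_mul_le hux t t
  have key := integral_Ioi_of_hasDerivAt_of_tendsto (a := (0 : ℝ)) (m := (0 : ℝ))
    (f := fun x => inner ℝ (u (x, t)) (Complex.I * ux (x, t)))
    (f' := fun x => inner ℝ (u (x, t)) (Complex.I * uxx (x, t)))
    ((hcont u hu).inner (𝕜 := ℝ) (continuousWithinAt_const.mul (hcont ux hux))) ?_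
    (hu.integrable_inner (huxx.const_mul Complex.I) t) ?_
  · simpa [hbc] using key
  · intro x hx
    have h := (hd x hx t).inner ℝ ((hdd x hx t).const_mul Complex.I)
    have h0 : inner ℝ (ux (x, t)) (Complex.I * ux (x, t)) = 0 := by
      simp [Complex.inner]
      ring
    rwa [h0, add_zero] at h
  · have hlim : Tendsto (fun x : ℝ => C * (1 + x ^ 2)⁻¹) atTop (𝓝 0) := by
      rw [← mul_zero C]
      refine Tendsto.const_mul C (tendsto_inv_atTop_zero.comp ?_)
      exact tendsto_atTop_add_const_left _ _ (tendsto_pow_atTop two_ne_zero)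
    refine squeeze_zero_norm' ?_ hlim
    filter_upwards [eventually_gt_atTop 0] with x hx
    refine (norm_inner_le_norm _ _).trans ?_
    simpa using hC x hx t (by simp)

end RapidDecay

/-- If the derivative of `E` is at most `2 √E N` in absolute value, then `√E` varies by at most `∫ N`. -/
theorem abs_sqrt_sub_sqrt_le_integral {E E' N : ℝ → ℝ} (hE : ∀ t, 0 ≤ E t)
    (hd : ∀ t, HasDerivAt E (E' t) t) (hN : Continuous N) (hN0 : ∀ t, 0 ≤ N t)
    (hbound : ∀ t, |E' t| ≤ 2 * (√(E t) * N t)) {a b : ℝ} (hab : a ≤ b) :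
    |√(E b) - √(E a)| ≤ ∫ t in a..b, N t := by
  have key : ∀ ε > 0, |√(E b + ε) - √(E a + ε)| ≤ ∫ t in a..b, N t := by
    intro ε hε
    have hpos (t : ℝ) : 0 < √(E t + ε) := Real.sqrt_pos.2 (by linarith [hE t])
    have hder (t : ℝ) : HasDerivAt (fun s => √(E s + ε) - √(E a + ε))
        (E' t / (2 * √(E t + ε))) t :=
      (((hd t).add_const ε).sqrt (Real.sqrt_pos.1 (hpos t)).ne').sub_const _
    refine image_norm_le_of_norm_deriv_right_le_deriv_boundary (a := a) (b := b)
      (f := fun s => √(E s + ε) - √(E a + ε)) (B := fun t => ∫ s in a..t, N s) (B' := N)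
      (fun t _ => (hder t).continuousAt.continuousWithinAt)
      (fun t _ => (hder t).hasDerivWithinAt) (by simp)
      (fun t => intervalIntegral.integral_hasDerivAt_right (hN.intervalIntegrable _ _)
        (hN.stronglyMeasurableAtFilter _ _) hN.continuousAt) ?_ (right_mem_Icc.2 hab)
    intro t _
    rw [Real.norm_eq_abs, abs_div, abs_of_pos (mul_pos two_pos (hpos t)),
      div_le_iff₀ (mul_pos two_pos (hpos t))]
    have h1 : √(E t) ≤ √(E t + ε) := Real.sqrt_le_sqrt (by linarith)
    have h2 := mul_le_mul_of_nonneg_right h1 (hN0 t)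
    linarith [hbound t]
  have hlim : Tendsto (fun ε => |√(E b + ε) - √(E a + ε)|) (𝓝[>] 0)
      (𝓝 |√(E b + 0) - √(E a + 0)|) :=
    (Continuous.tendsto (by fun_prop) 0).mono_left nhdsWithin_le_nhds
  rw [add_zero, add_zero] at hlim
  exact le_of_tendsto hlim (eventually_nhdsWithin_of_forall key)

/-- Cook-type estimate: for ψ smooth on the closed half-plane,
vanishing at x = 0, and super-algebraically decaying as x → +∞ uniformly on
bounded t-intervals,
| ‖ψ(·,t₂)‖_{L²(0,∞)} − ‖ψ(·,t₁)‖_{L²(0,∞)} | ≤ ∫_{t₁}^{t₂} ‖(Lψ)(·,t′)‖_{L²(0,∞)} dt′. -/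
theorem statement19 (ψ : ℝ → ℝ → ℂ)
    (hsmooth : ContDiffOn ℝ (⊤ : ℕ∞) (Function.uncurry ψ) {p : ℝ × ℝ | 0 ≤ p.1})
    (hbc : ∀ t : ℝ, ψ 0 t = 0)
    (hdecay : ∀ (α β γ : ℕ) (A₁ A₂ : ℝ), A₁ < A₂ → ∀ ε > 0, ∃ X : ℝ, ∀ x ≥ X,
      ∀ t ∈ Set.Icc A₁ A₂, x ^ α * ‖(pdT^[β] (pdX^[γ] ψ)) x t‖ < ε)
    (t₁ t₂ : ℝ) (h : t₁ ≤ t₂) :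
    |L2h (fun x => ψ x t₂) - L2h (fun x => ψ x t₁)|
      ≤ ∫ t' in t₁..t₂, L2h (fun x => Lop ψ x t') := by
  set u : ℝ × ℝ → ℂ := Function.uncurry ψ with hu_def
  obtain ⟨ux, hux, hdx⟩ := exists_partial_fst hsmooth
  obtain ⟨uxx, huxx, hdxx⟩ := exists_partial_fst hux
  obtain ⟨ut, hut, hdt⟩ := exists_partial_snd hsmooth
  have ex : ∀ x > 0, ∀ t, pdX ψ x t = ux (x, t) := fun x hx t => (hdx x hx t).deriv
  have et : ∀ x > 0, ∀ t, pdT ψ x t = ut (x, t) := fun x hx t => (hdt x hx t).deriv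
  have exx : ∀ x > 0, ∀ t, pdX (pdX ψ) x t = uxx (x, t) := by
    intro x hx t
    refine ((hdxx x hx t).congr_of_eventuallyEq ?_).deriv
    filter_upwards [lt_mem_nhds hx] with y hy using ex y hy t
  have Ru : RapidDecay u := .of_eventually hsmooth.continuousOn fun α A B hAB => by
    obtain ⟨X, hX⟩ := hdecay α 0 0 A B hAB 1 one_pos
    exact ⟨X, fun x hx _ t ht => hX x hx t ht⟩
  have Rux : RapidDecay ux := .of_eventually hux.continuousOn fun α A B hAB => by
    obtain ⟨X, hX⟩ := hdecay α 0 1 A B hAB 1 one_pos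
    exact ⟨X, fun x hx hx0 t ht => ex x hx0 t ▸ hX x hx t ht⟩
  have Ruxx : RapidDecay uxx := .of_eventually huxx.continuousOn fun α A B hAB => by
    obtain ⟨X, hX⟩ := hdecay α 0 2 A B hAB 1 one_pos
    exact ⟨X, fun x hx hx0 t ht => exx x hx0 t ▸ hX x hx t ht⟩
  have Rut : RapidDecay ut := .of_eventually hut.continuousOn fun α A B hAB => by
    obtain ⟨X, hX⟩ := hdecay α 1 0 A B hAB 1 one_pos
    exact ⟨X, fun x hx hx0 t ht => et x hx0 t ▸ hX x hx t ht⟩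
  set F : ℝ × ℝ → ℂ := fun p =>
    Complex.I * ut p + (1 / 2) * uxx p + (p.1 : ℂ) * (p.2 : ℂ) * u p with hF
  have RF : RapidDecay F := ((Rut.const_mul _).add (Ruxx.const_mul _)).add Ru.coord_mul
  have hL (t : ℝ) : L2h (fun x => Lop ψ x t) = L2h (fun x => F (x, t)) := by
    unfold L2h
    congr 1
    refine setIntegral_congr_fun measurableSet_Ioi fun x hx => ?_
    simp only [Lop, hF, et x hx t, exx x hx t]
    rfl
  simp only [hL]
  refine abs_sqrt_sub_sqrt_le_integral (E := fun t => ∫ x in Ioi (0 : ℝ), ‖u (x, t)‖ ^ 2)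
    (N := fun t => L2h fun x => F (x, t))
    (fun t => integral_nonneg fun x => by positivity)
    (Ru.hasDerivAt_integral_norm_sq Rut hdt) RF.continuous_integral_norm_sq.sqrt
    (fun t => Real.sqrt_nonneg _) (fun t => ?_) h
  have hsplit (x : ℝ) : inner ℝ (u (x, t)) (ut (x, t)) =
      inner ℝ (u (x, t)) (-Complex.I * F (x, t)) +
        (1 / 2) * inner ℝ (u (x, t)) (Complex.I * uxx (x, t)) := by
    simp [hF, Complex.inner]
    ring
  have RIF := RF.const_mul (-Complex.I)
  rw [integral_const_mul, abs_mul, abs_of_pos two_pos]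
  simp_rw [hsplit]
  rw [integral_add (Ru.integrable_inner RIF t)
    ((Ru.integrable_inner (Ruxx.const_mul Complex.I) t).const_mul _), integral_const_mul,
    Ru.integral_inner_I_mul_eq_zero Rux Ruxx hbc hdx hdxx t, mul_zero, add_zero]
  gcongr
  refine le_trans ?_ (Ru.integral_norm_mul_norm_le RF t)
  rw [← Real.norm_eq_abs]
  refine norm_integral_le_of_norm_le (Ru.integrable_mul_norm RF t) (ae_of_all _ fun x => ?_)
  simpa using norm_inner_le_norm (𝕜 := ℝ) (u (x, t)) (-Complex.I * F (x, t))
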